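/- Let n ≥ 1 and write R = R_e ⊕ R_g, where R_e is the ℤ/2-span of the monomials x^a w^c (0 ≤ a ≤ 2n+1, c ≥ 0) and R_g is the ℤ/2-span of the monomials x^a v w^c (0 ≤ a ≤ 2n+1, c ≥ 0). Suppose (R, Δ) is a char-2 B-V datum such that Δ is homogeneous of degree +1 for the grading deg(x^a v^b w^c) = −a + 2nc, Δ vanishes identically on R_e, Δ(R_g) ⊆ R_g, and Δ(x^{2n+1}·v) = x^{2n}·v. Then Δ(x) = 0, Δ(v) = 0, Δ(w) = 0, {x,w} = 0, {v,w} = 0, and either {x,v} = v or {x,v} = v + x^{2n}·v·w. -/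

import Mathlib

open MvPolynomial

noncomputable section

/-- The polynomial ring `(ℤ/2)[x,v,w]`. -/
abbrev P : Type := MvPolynomial (Fin 3) (ZMod 2)

/-- The ideal `(x^{2n+2}, v² + (n+1)·x^{2n}·w)` (the coefficient `n+1` read mod 2). -/
def relIdeal (n : ℕ) : Ideal P :=
  Ideal.span {(X 0 : P) ^ (2 * n + 2),
    (X 1 : P) ^ 2 + C ((n : ZMod 2) + 1) * (X 0 : P) ^ (2 * n) * X 2}

/-- `R = (ℤ/2)[x,v,w]/(x^{2n+2}, v² + (n+1)x^{2n}w) ≅ ℍ_*(L ℝP^{2n+1}; ℤ/2)`. -/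
abbrev R (n : ℕ) : Type := P ⧸ relIdeal n

/-- The quotient map as a `ℤ/2`-algebra homomorphism. -/
def mkR (n : ℕ) : P →ₐ[ZMod 2] R n := Ideal.Quotient.mkₐ (ZMod 2) (relIdeal n)

def x (n : ℕ) : R n := mkR n (X 0)
def v (n : ℕ) : R n := mkR n (X 1)
def w (n : ℕ) : R n := mkR n (X 2)

/-- `R_e`: the `ℤ/2`-span of the monomials `x^a w^c` with `0 ≤ a ≤ 2n+1`, `c ≥ 0`. -/
def Re (n : ℕ) : Submodule (ZMod 2) (R n) :=
  Submodule.span (ZMod 2) {y : R n | ∃ a c : ℕ, a ≤ 2 * n + 1 ∧ y = x n ^ a * w n ^ c}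

/-- `R_g`: the `ℤ/2`-span of the monomials `x^a v w^c` with `0 ≤ a ≤ 2n+1`, `c ≥ 0`. -/
def Rg (n : ℕ) : Submodule (ZMod 2) (R n) :=
  Submodule.span (ZMod 2) {y : R n | ∃ a c : ℕ, a ≤ 2 * n + 1 ∧ y = x n ^ a * v n * w n ^ c}

/-- The homogeneous component of degree `d` of `R` for the grading
`deg (x^a v^b w^c) = -a + 2nc`. -/
def Rdeg (n : ℕ) (d : ℤ) : Submodule (ZMod 2) (R n) :=
  Submodule.span (ZMod 2) {y : R n | ∃ a b c : ℕ, a ≤ 2 * n + 1 ∧ b ≤ 1 ∧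
    y = x n ^ a * v n ^ b * w n ^ c ∧ -(a : ℤ) + 2 * n * c = d}

theorem two_eq_zero_R (n : ℕ) : (2 : R n) = 0 := by
  have h : (algebraMap (ZMod 2) (R n)) 2 = 0 := by
    rw [show (2 : ZMod 2) = 0 from rfl, map_zero]
  exact (map_ofNat _ 2).symm.trans h

theorem x_pow_add_eq_zero (n k : ℕ) : x n ^ (2 * n + 2 + k) = 0 := by
  have h : x n ^ (2 * n + 2) = 0 := by
    rw [x, ← map_pow]
    exact Ideal.Quotient.eq_zero_iff_mem.2 (Ideal.subset_span (Set.mem_insert _ _))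
  rw [pow_add, h, zero_mul]

/-- A linear functional on the polynomial ring vanishing on `relIdeal n` and detecting
the monomial `x^{2n} v w^{j+1}`. -/
theorem coeff_eq_of_mem_relIdeal {n : ℕ} (hn : 1 ≤ n) (j : ℕ) {p : P} (hp : p ∈ relIdeal n) :
    coeff (Finsupp.single 0 (2 * n) + Finsupp.single 1 1 + Finsupp.single 2 (j + 1)) p
      + ((n : ZMod 2) + 1) * coeff (Finsupp.single 1 3 + Finsupp.single 2 j) p = 0 := by
  obtain ⟨f, g, rfl⟩ := Ideal.mem_span_pair.1 hp
  have e0 : (X 0 : P) ^ (2 * n + 2) = monomial (Finsupp.single 0 (2 * n + 2)) 1 := by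
    rw [X_pow_eq_monomial]
  have e1 : (X 1 : P) ^ 2 = monomial (Finsupp.single 1 2) 1 := by
    rw [X_pow_eq_monomial]
  have e2 : C ((n : ZMod 2) + 1) * (X 0 : P) ^ (2 * n) * X 2
      = monomial (Finsupp.single 0 (2 * n) + Finsupp.single 2 1) ((n : ZMod 2) + 1) := by
    rw [X_pow_eq_monomial, X, mul_assoc, monomial_mul, C_mul_monomial]
    simp
  rw [e0, e1, e2, mul_add]
  simp only [coeff_add, coeff_mul_monomial']
  have h1 : ¬ (Finsupp.single (0 : Fin 3) (2 * n + 2) ≤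
      Finsupp.single 0 (2 * n) + Finsupp.single 1 1 + Finsupp.single 2 (j + 1)) := by
    intro h; simpa using h 0
  have h2 : ¬ (Finsupp.single (1 : Fin 3) 2 ≤
      Finsupp.single 0 (2 * n) + Finsupp.single 1 1 + Finsupp.single 2 (j + 1)) := by
    intro h; simpa using h 1
  have h3 : Finsupp.single (0 : Fin 3) (2 * n) + Finsupp.single 2 1 ≤
      Finsupp.single 0 (2 * n) + Finsupp.single 1 1 + Finsupp.single 2 (j + 1) := by
    intro i; fin_cases i <;> simp
  have h4 : ¬ (Finsupp.single (0 : Fin 3) (2 * n + 2) ≤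
      Finsupp.single 1 3 + Finsupp.single 2 j) := by
    intro h; simpa using h 0
  have h5 : Finsupp.single (1 : Fin 3) 2 ≤ Finsupp.single 1 3 + Finsupp.single 2 j := by
    intro i; fin_cases i <;> simp
  have h6 : ¬ (Finsupp.single (0 : Fin 3) (2 * n) + Finsupp.single 2 1 ≤
      Finsupp.single 1 3 + Finsupp.single 2 j) := by
    intro h
    have := h 0
    simp at this
    omega
  have h7 : Finsupp.single (0 : Fin 3) (2 * n) + Finsupp.single 1 1 + Finsupp.single 2 (j + 1)
      - (Finsupp.single 0 (2 * n) + Finsupp.single 2 1)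
      = Finsupp.single 1 1 + Finsupp.single 2 j := by
    ext i; fin_cases i <;> simp
  have h8 : Finsupp.single (1 : Fin 3) 3 + Finsupp.single 2 j - Finsupp.single 1 2
      = Finsupp.single 1 1 + Finsupp.single 2 j := by
    ext i; fin_cases i <;> simp
  rw [if_neg h1, if_neg h2, if_pos h3, if_neg h4, if_pos h5, if_neg h6, h7, h8]
  have c2 : (2 : ZMod 2) = 0 := rfl
  linear_combination ((n : ZMod 2) + 1) *
    coeff (Finsupp.single 1 1 + Finsupp.single 2 j) g * c2

theorem x_pow_mul_v_mul_w_pow_ne_zero {n : ℕ} (hn : 1 ≤ n) (j : ℕ) :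
    x n ^ (2 * n) * v n * w n ^ (j + 1) ≠ 0 := by
  intro h
  have e : x n ^ (2 * n) * v n * w n ^ (j + 1)
      = mkR n (monomial (Finsupp.single 0 (2 * n) + Finsupp.single 1 1
          + Finsupp.single 2 (j + 1)) 1) := by
    have : (monomial (Finsupp.single 0 (2 * n) + Finsupp.single 1 1
          + Finsupp.single 2 (j + 1)) 1 : P) = X 0 ^ (2 * n) * X 1 * X 2 ^ (j + 1) := by
      simp only [X, monomial_pow, monomial_mul, one_pow, mul_one, Finsupp.smul_single,
        smul_eq_mul]
    rw [this]
    simp [x, v, w]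
  rw [e] at h
  have h' := coeff_eq_of_mem_relIdeal hn j (Ideal.Quotient.eq_zero_iff_mem.1 h)
  have hne : Finsupp.single (0 : Fin 3) (2 * n) + Finsupp.single 1 1 + Finsupp.single 2 (j + 1)
      ≠ Finsupp.single 1 3 + Finsupp.single 2 j := by
    intro h
    have := DFunLike.congr_fun h 1
    simp at this
  rw [coeff_monomial, coeff_monomial, if_pos rfl, if_neg hne] at h'
  simp at h'

/-- If `R = R_e ⊕ R_g`, then a homogeneous element of `R_g` is a combination of the
monomials `x^a v w^c` of the same degree. -/
theorem mem_span_of_mem_Rdeg_of_mem_Rg {n : ℕ} (hcompl : IsCompl (Re n) (Rg n)) {d : ℤ} {y : R n}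
    (hd : y ∈ Rdeg n d) (hg : y ∈ Rg n) :
    y ∈ Submodule.span (ZMod 2) {z : R n | ∃ a c : ℕ, a ≤ 2 * n + 1 ∧
      z = x n ^ a * v n * w n ^ c ∧ -(a : ℤ) + 2 * n * c = d} := by
  set S := Submodule.span (ZMod 2) {z : R n | ∃ a c : ℕ, a ≤ 2 * n + 1 ∧
      z = x n ^ a * v n * w n ^ c ∧ -(a : ℤ) + 2 * n * c = d} with hS
  have hSg : S ≤ Rg n := Submodule.span_mono fun z ⟨a, c, ha, hz, _⟩ => ⟨a, c, ha, hz⟩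
  have hsup : Rdeg n d ≤ Re n ⊔ S := by
    refine Submodule.span_le.2 ?_
    rintro z ⟨a, b, c, ha, hb, rfl, hdeg⟩
    interval_cases b
    · exact Submodule.mem_sup_left (Submodule.subset_span ⟨a, c, ha, by simp⟩)
    · exact Submodule.mem_sup_right (Submodule.subset_span ⟨a, c, ha, by simp, hdeg⟩)
  obtain ⟨e, he, s, hs, rfl⟩ := Submodule.mem_sup.1 (hsup hd)
  have he' : e ∈ Rg n := by simpa using (Rg n).sub_mem hg (hSg hs)
  have : e = 0 := Submodule.disjoint_def.1 hcompl.disjoint e he he'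
  simpa [this] using hs

theorem exists_eq_of_mem_Rdeg_zero {n : ℕ} (hn : 1 ≤ n) (hcompl : IsCompl (Re n) (Rg n)) {y : R n}
    (hd : y ∈ Rdeg n 0) (hg : y ∈ Rg n) :
    ∃ a b : ZMod 2, a • v n + b • (x n ^ (2 * n) * v n * w n) = y := by
  refine Submodule.mem_span_pair.1 (Submodule.span_le.2 ?_
    (mem_span_of_mem_Rdeg_of_mem_Rg hcompl hd hg))
  rintro z ⟨a, c, ha, rfl, h⟩
  refine Submodule.subset_span ?_
  have hc : c < 2 := by
    by_contra hc
    have : (2 : ℤ) * n * 2 ≤ 2 * n * c := by gcongr; omega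
    omega
  interval_cases c
  · obtain rfl : a = 0 := by omega
    simp
  · obtain rfl : a = 2 * n := by omega
    simp

theorem exists_eq_of_mem_Rdeg_add_one {m k : ℕ} (hcompl : IsCompl (Re (m + 1)) (Rg (m + 1)))
    {y : R (m + 1)} (hd : y ∈ Rdeg (m + 1) (2 * (m + 1 : ℕ) * k + 1)) (hg : y ∈ Rg (m + 1)) :
    ∃ a b : ZMod 2, a • (x (m + 1) ^ (2 * m + 1) * v (m + 1) * w (m + 1) ^ (k + 1))
      + b • (x (m + 1) ^ (2 * (2 * m + 1) + 1) * v (m + 1) * w (m + 1) ^ (k + 2)) = y := by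
  refine Submodule.mem_span_pair.1 (Submodule.span_le.2 ?_
    (mem_span_of_mem_Rdeg_of_mem_Rg hcompl hd hg))
  rintro z ⟨a, c, ha, rfl, h⟩
  refine Submodule.subset_span ?_
  have hck : k < c := by
    by_contra hc
    have : (2 : ℤ) * (m + 1 : ℕ) * c ≤ 2 * (m + 1 : ℕ) * k := by gcongr; omega
    omega
  obtain ⟨i, rfl⟩ := Nat.exists_eq_add_of_lt hck
  have hi : (a : ℤ) + 1 = 2 * (m + 1) * (i + 1) := by
    push_cast at h
    linear_combination -h
  have hi2 : i < 2 := by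
    by_contra hi2
    have : (2 : ℤ) * (m + 1) * 3 ≤ 2 * (m + 1) * (i + 1) := by gcongr; omega
    omega
  interval_cases i
  · obtain rfl : a = 2 * m + 1 := by push_cast at hi; omega
    simp
  · obtain rfl : a = 2 * (2 * m + 1) + 1 := by push_cast at hi; omega
    simp [add_assoc]

theorem zmod_two_eq_zero_or_one : ∀ a : ZMod 2, a = 0 ∨ a = 1 := by decide

/-- A `ℤ/2`-combination of two elements has coefficients `0` or `1` in the ring. -/
theorem exists_coeff_of_exists_smul {A : Type*} [CommRing A] [Algebra (ZMod 2) A] {y z t : A}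
    (h : ∃ a b : ZMod 2, a • y + b • z = t) :
    ∃ a b : A, (a = 0 ∨ a = 1) ∧ (b = 0 ∨ b = 1) ∧ t = a * y + b * z := by
  obtain ⟨a, b, rfl⟩ := h
  refine ⟨algebraMap _ A a, algebraMap _ A b, ?_, ?_, by simp only [Algebra.smul_def]⟩
  · rcases zmod_two_eq_zero_or_one a with rfl | rfl <;> simp
  · rcases zmod_two_eq_zero_or_one b with rfl | rfl <;> simp

section BVDatum

variable {A : Type*} [CommRing A] {x v w : A} {Δ : A → A} {br : A → A → A} {m : ℕ}

theorem delta_x_pow_mul_v_mul_w_pow (h2 : (2 : A) = 0)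
    (hbr : ∀ a b : A, br a b = Δ (a * b) + Δ a * b + a * Δ b)
    (hleib : ∀ a b c : A, br a (b * c) = br a b * c + b * br a c)
    (he : ∀ a c, Δ (x ^ a * w ^ c) = 0) (a c : ℕ) :
    Δ (x ^ (2 * a) * v * w ^ c) = x ^ (2 * a) * Δ (v * w ^ c) ∧
    Δ (x ^ (2 * a + 1) * v * w ^ c)
      = x ^ (2 * a + 1) * Δ (v * w ^ c) + x ^ (2 * a) * w ^ c * br x v := by
  have hΔx : Δ x = 0 := by simpa using he 1 0
  have hbrx : ∀ a c, br x (x ^ a * w ^ c) = 0 := by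
    intro a c
    rw [hbr, he, hΔx, ← mul_assoc, ← pow_succ', he]
    ring
  have hbrxg : ∀ a c, br x (x ^ a * v * w ^ c) = x ^ a * w ^ c * br x v := by
    intro a c
    rw [show x ^ a * v * w ^ c = v * (x ^ a * w ^ c) by ring, hleib, hbrx]
    ring
  have hstep : ∀ a c, Δ (x ^ (a + 1) * v * w ^ c)
      = x * Δ (x ^ a * v * w ^ c) + x ^ a * w ^ c * br x v := by
    intro a c
    have h := hbr x (x ^ a * v * w ^ c)
    rw [hbrxg, hΔx, show x * (x ^ a * v * w ^ c) = x ^ (a + 1) * v * w ^ c by ring] at h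
    linear_combination -h - x * Δ (x ^ a * v * w ^ c) * h2
  have heven : Δ (x ^ (2 * a) * v * w ^ c) = x ^ (2 * a) * Δ (v * w ^ c) := by
    induction a with
    | zero => simp
    | succ i ih =>
      rw [show 2 * (i + 1) = 2 * i + 1 + 1 by ring, hstep, hstep, ih]
      linear_combination x ^ (2 * i + 1) * w ^ c * br x v * h2
  refine ⟨heven, ?_⟩
  rw [hstep, heven]
  ring

theorem bracket_x_v_eq (h2 : (2 : A) = 0)
    (hx0 : x ^ (2 * m + 4) = 0)
    (hne : ∀ j, x ^ (2 * m + 2) * v * w ^ (j + 1) ≠ 0)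
    (hbr : ∀ a b : A, br a b = Δ (a * b) + Δ a * b + a * Δ b)
    (hleib : ∀ a b c : A, br a (b * c) = br a b * c + b * br a c)
    (he : ∀ a c, Δ (x ^ a * w ^ c) = 0)
    (hv : ∃ a b : A, (a = 0 ∨ a = 1) ∧ (b = 0 ∨ b = 1) ∧
      Δ v = a * (x ^ (2 * m + 1) * v * w)
        + b * (x ^ (2 * (2 * m + 1) + 1) * v * w ^ 2))
    (hxv : ∃ a b : A, (a = 0 ∨ a = 1) ∧ (b = 0 ∨ b = 1) ∧
      Δ (x * v) = a * v + b * (x ^ (2 * m + 2) * v * w))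
    (hkey : Δ (x ^ (2 * m + 3) * v) = x ^ (2 * m + 2) * v) :
    br x v = v ∨ br x v = v + x ^ (2 * m + 2) * v * w := by
  have hΔx : Δ x = 0 := by simpa using he 1 0
  obtain ⟨c, d, hc, hd, hv⟩ := hv
  obtain ⟨a, b, ha, hb, hxv⟩ := hxv
  have hD : br x v = a * v + (b + c) * (x ^ (2 * m + 2) * v * w) := by
    rw [hbr, hΔx, hxv, hv]
    linear_combination (d * v * w ^ 2 * x ^ (2 * m)) * hx0
  rcases ha with rfl | rfl
  · exfalso
    have h := (delta_x_pow_mul_v_mul_w_pow (v := v) h2 hbr hleib he (m + 1) 0).2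
    simp only [pow_zero, mul_one] at h
    rw [show 2 * (m + 1) + 1 = 2 * m + 3 by ring, hkey, hD, hv] at h
    refine hne 0 ?_
    linear_combination w * h + (c * x ^ (2 * m) * v * w ^ 2
      + d * x ^ (4 * m + 2) * v * w ^ 3 + (b + c) * x ^ (2 * m) * v * w ^ 2) * hx0
  · rcases hb with rfl | rfl <;> rcases hc with rfl | rfl
    · left; linear_combination hD
    · right; linear_combination hD
    · right; linear_combination hD
    · left; linear_combination hD + x ^ (2 * m + 2) * v * w * h2

theorem delta_v_mul_w_pow_eq_zero (h2 : (2 : A) = 0)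
    (hx0 : x ^ (2 * m + 4) = 0)
    (hne : ∀ j, x ^ (2 * m + 2) * v * w ^ (j + 1) ≠ 0)
    (hΔadd : ∀ a b : A, Δ (a + b) = Δ a + Δ b)
    (hΔΔ : ∀ a : A, Δ (Δ a) = 0)
    (hbr : ∀ a b : A, br a b = Δ (a * b) + Δ a * b + a * Δ b)
    (hleib : ∀ a b c : A, br a (b * c) = br a b * c + b * br a c)
    (he : ∀ a c, Δ (x ^ a * w ^ c) = 0)
    (hv : ∀ k, ∃ a b : A, (a = 0 ∨ a = 1) ∧ (b = 0 ∨ b = 1) ∧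
      Δ (v * w ^ k) = a * (x ^ (2 * m + 1) * v * w ^ (k + 1))
        + b * (x ^ (2 * (2 * m + 1) + 1) * v * w ^ (k + 2)))
    {b : A} (hD : br x v = v + b * (x ^ (2 * m + 2) * v * w)) (k : ℕ) :
    Δ (v * w ^ k) = 0 := by
  have hodd := fun i c => (delta_x_pow_mul_v_mul_w_pow (v := v) h2 hbr hleib he i c).2
  have hdvd : ∀ k, ∃ z, Δ (v * w ^ k) = x ^ (2 * m + 1) * z := by
    intro k
    obtain ⟨a, b, -, -, h⟩ := hv k
    exact ⟨a * (v * w ^ (k + 1)) + b * (x ^ (2 * m + 2) * v * w ^ (k + 2)), by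
      rw [h]; ring⟩
  obtain ⟨y, hy⟩ := hdvd (k + 1)
  obtain ⟨z, hz⟩ := hdvd (k + 2)
  have hA := hodd m (k + 1)
  have hB := hodd (2 * m + 1) (k + 2)
  rw [hD, hy] at hA
  rw [hD, hz] at hB
  have h0 := hΔΔ (v * w ^ k)
  obtain ⟨p, q, hp, hq, h⟩ := hv k
  rw [h] at h0 ⊢
  rcases hp with rfl | rfl
  · rcases hq with rfl | rfl
    · ring
    · simp only [zero_mul, zero_add, one_mul] at h0 ⊢
      rw [hB] at h0
      linear_combination x * h0 - (x ^ (4 * m + 1) * z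
        + b * x ^ (4 * m + 1) * v * w ^ (k + 3)) * hx0
  · exfalso
    refine hne k ?_
    have h1 : ∃ t, Δ (q * (x ^ (2 * (2 * m + 1) + 1) * v * w ^ (k + 2)))
        = x ^ (2 * (2 * m + 1)) * t := by
      rcases hq with rfl | rfl
      · exact ⟨0, by simpa [hx0] using he (2 * m + 4) 0⟩
      · exact ⟨_, by rw [one_mul, hB, pow_succ, mul_assoc, mul_assoc, mul_assoc, ← mul_add]⟩
    obtain ⟨t, ht⟩ := h1
    rw [one_mul, hΔadd, hA, ht] at h0
    linear_combination x ^ 2 * h0 - (x ^ (2 * m) * y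
      + b * x ^ (2 * m) * v * w ^ (k + 2) + x ^ (2 * m) * t) * hx0

theorem bvDatum_structure (h2 : (2 : A) = 0)
    (hx0 : x ^ (2 * m + 4) = 0)
    (hne : ∀ j, x ^ (2 * m + 2) * v * w ^ (j + 1) ≠ 0)
    (hΔadd : ∀ a b : A, Δ (a + b) = Δ a + Δ b)
    (hΔΔ : ∀ a : A, Δ (Δ a) = 0)
    (hbr : ∀ a b : A, br a b = Δ (a * b) + Δ a * b + a * Δ b)
    (hleib : ∀ a b c : A, br a (b * c) = br a b * c + b * br a c)
    (he : ∀ a c, Δ (x ^ a * w ^ c) = 0)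
    (hv : ∀ k, ∃ a b : A, (a = 0 ∨ a = 1) ∧ (b = 0 ∨ b = 1) ∧
      Δ (v * w ^ k) = a * (x ^ (2 * m + 1) * v * w ^ (k + 1))
        + b * (x ^ (2 * (2 * m + 1) + 1) * v * w ^ (k + 2)))
    (hxv : ∃ a b : A, (a = 0 ∨ a = 1) ∧ (b = 0 ∨ b = 1) ∧
      Δ (x * v) = a * v + b * (x ^ (2 * m + 2) * v * w))
    (hkey : Δ (x ^ (2 * m + 3) * v) = x ^ (2 * m + 2) * v) :
    Δ x = 0 ∧ Δ v = 0 ∧ Δ w = 0 ∧ br x w = 0 ∧ br v w = 0 ∧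
    (br x v = v ∨ br x v = v + x ^ (2 * m + 2) * v * w) := by
  have hD := bracket_x_v_eq h2 hx0 hne hbr hleib he (by simpa using hv 0) hxv hkey
  have hvw : ∀ k, Δ (v * w ^ k) = 0 := by
    rcases hD with hD | hD
    · exact delta_v_mul_w_pow_eq_zero h2 hx0 hne hΔadd hΔΔ hbr hleib he hv (b := 0)
        (by rw [hD]; ring)
    · exact delta_v_mul_w_pow_eq_zero h2 hx0 hne hΔadd hΔΔ hbr hleib he hv (b := 1)
        (by rw [hD]; ring)
  have hΔx : Δ x = 0 := by simpa using he 1 0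
  have hΔw : Δ w = 0 := by simpa using he 0 1
  have hΔv : Δ v = 0 := by simpa using hvw 0
  have hΔxw : Δ (x * w) = 0 := by simpa using he 1 1
  have hΔvw : Δ (v * w) = 0 := by simpa using hvw 1
  refine ⟨hΔx, hΔv, hΔw, ?_, ?_, hD⟩
  · rw [hbr, hΔx, hΔw, hΔxw]; ring
  · rw [hbr, hΔv, hΔw, hΔvw]; ring

end BVDatum

/-- Case (A) of Theorem 4.1: if `(R, Δ)` is a char-2 B-V datum, `R = R_e ⊕ R_g`,
`Δ` is homogeneous of degree `+1`, `Δ` vanishes on `R_e`, `Δ(R_g) ⊆ R_g`, and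
`Δ(x^{2n+1} v) = x^{2n} v`, then `Δ x = Δ v = Δ w = 0`, `⁅x,w⁆ = 0`, `⁅v,w⁆ = 0`,
and `⁅x,v⁆ = v` or `⁅x,v⁆ = v + x^{2n} v w`. -/
theorem stmt_15 (n : ℕ) (hn : 1 ≤ n)
    (Δ : R n → R n) (hΔadd : ∀ a b : R n, Δ (a + b) = Δ a + Δ b)
    (hΔΔ : ∀ a : R n, Δ (Δ a) = 0)
    (br : R n → R n → R n)
    (hbr : ∀ a b : R n, br a b = Δ (a * b) + Δ a * b + a * Δ b)
    (halt : ∀ a : R n, br a a = 0)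
    (hleib : ∀ a b c : R n, br a (b * c) = br a b * c + b * br a c)
    (hcompl : IsCompl (Re n) (Rg n))
    (hΔdeg : ∀ (d : ℤ) (y : R n), y ∈ Rdeg n d → Δ y ∈ Rdeg n (d + 1))
    (hΔe : ∀ y ∈ Re n, Δ y = 0)
    (hΔg : ∀ y ∈ Rg n, Δ y ∈ Rg n)
    (hkey : Δ (x n ^ (2 * n + 1) * v n) = x n ^ (2 * n) * v n) :
    Δ (x n) = 0 ∧ Δ (v n) = 0 ∧ Δ (w n) = 0 ∧
    br (x n) (w n) = 0 ∧ br (v n) (w n) = 0 ∧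
    (br (x n) (v n) = v n ∨
      br (x n) (v n) = v n + x n ^ (2 * n) * v n * w n) := by
  obtain ⟨m, rfl⟩ : ∃ m, n = m + 1 := ⟨n - 1, by omega⟩
  have h2 := two_eq_zero_R (m + 1)
  have hx0 : x (m + 1) ^ (2 * m + 4) = 0 := x_pow_add_eq_zero (m + 1) 0
  have hne : ∀ j, x (m + 1) ^ (2 * m + 2) * v (m + 1) * w (m + 1) ^ (j + 1) ≠ 0 :=
    x_pow_mul_v_mul_w_pow_ne_zero hn
  have he : ∀ a c, Δ (x (m + 1) ^ a * w (m + 1) ^ c) = 0 := by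
    intro a c
    by_cases ha : a ≤ 2 * (m + 1) + 1
    · exact hΔe _ (Submodule.subset_span ⟨a, c, ha, rfl⟩)
    · obtain ⟨k, rfl⟩ := Nat.exists_eq_add_of_le (show 2 * (m + 1) + 2 ≤ a by omega)
      rw [x_pow_add_eq_zero, zero_mul]
      exact hΔe 0 (Re _).zero_mem
  have hv : ∀ k, ∃ a b : R (m + 1), (a = 0 ∨ a = 1) ∧ (b = 0 ∨ b = 1) ∧
      Δ (v (m + 1) * w (m + 1) ^ k)
        = a * (x (m + 1) ^ (2 * m + 1) * v (m + 1) * w (m + 1) ^ (k + 1))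
        + b * (x (m + 1) ^ (2 * (2 * m + 1) + 1) * v (m + 1) * w (m + 1) ^ (k + 2)) := by
    intro k
    refine exists_coeff_of_exists_smul
      (exists_eq_of_mem_Rdeg_add_one hcompl (hΔdeg _ _ ?_) (hΔg _ ?_))
    · exact Submodule.subset_span ⟨0, 1, k, by omega, le_rfl, by ring, by simp⟩
    · exact Submodule.subset_span ⟨0, k, by omega, by ring⟩
  have hxv : ∃ a b : R (m + 1), (a = 0 ∨ a = 1) ∧ (b = 0 ∨ b = 1) ∧
      Δ (x (m + 1) * v (m + 1)) = a * v (m + 1)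
        + b * (x (m + 1) ^ (2 * m + 2) * v (m + 1) * w (m + 1)) := by
    refine exists_coeff_of_exists_smul (exists_eq_of_mem_Rdeg_zero hn hcompl ?_ (hΔg _ ?_))
    · rw [← neg_add_cancel (1 : ℤ)]
      exact hΔdeg (-1) _ (Submodule.subset_span ⟨1, 1, 0, by omega, le_rfl, by ring, by simp⟩)
    · exact Submodule.subset_span ⟨1, 0, by omega, by ring⟩
  exact bvDatum_structure h2 hx0 hne hΔadd hΔΔ hbr hleib he hv hxv hkey

end
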